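/- Assume: (i) there exists γ₀ > 0 such that for all γ ∈ (0, γ₀] the measure m is the unique minimizer of F_γ over Borel probability measures on M; (ii) there exist γ̃ > 0 and a probability measure μ̃ ≠ m with F_γ̃(μ̃) ≤ F_γ̃(m). Then γ_c := sup{γ > 0 : m is a minimizer of F_γ} satisfies γ₀ ≤ γ_c ≤ γ̃ and γ_c is a transition point: for every γ ∈ (0, γ_c) the measure m is the unique minimizer of F_γ; m is a minimizer of F_{γ_c}; and for every γ > γ_c there exists a minimizer of F_γ different from m. -/

import Mathlib

open MeasureTheory
open scoped Classical

/-- The relative entropy `E(μ) = ∫ ρ log ρ dm` if `μ ≪ m` (with density `ρ`), `+∞` otherwise. -/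
noncomputable def entropy {M : Type*} [MeasurableSpace M] (m μ : Measure M) : EReal :=
  if μ ≪ m ∧
      Integrable (fun x => ((μ.rnDeriv m x).toReal) * Real.log ((μ.rnDeriv m x).toReal)) m
  then ((∫ x, ((μ.rnDeriv m x).toReal) * Real.log ((μ.rnDeriv m x).toReal) ∂m : ℝ) : EReal)
  else ⊤

/-- The interaction energy `I(μ) = (1/2) ∫∫ W(x,y) dμ(x) dμ(y)`. -/
noncomputable def interactionEnergy {M : Type*} [MeasurableSpace M]
    (W : M → M → ℝ) (μ : Measure M) : ℝ :=
  (1 / 2) * ∫ x, ∫ y, W x y ∂μ ∂μ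

/-- The free energy `F_γ(μ) = γ⁻¹ E(μ) + I(μ)`. -/
noncomputable def freeEnergy {M : Type*} [MeasurableSpace M]
    (m : Measure M) (W : M → M → ℝ) (γ : ℝ) (μ : Measure M) : EReal :=
  ((γ⁻¹ : ℝ) : EReal) * entropy m μ + ((interactionEnergy W μ : ℝ) : EReal)


open InformationTheory in
lemma entropy_eq_klDiv {M : Type*} [MeasurableSpace M] (m μ : Measure M)
    [IsProbabilityMeasure m] [IsProbabilityMeasure μ] :
    entropy m μ = ((klDiv μ m : ENNReal) : EReal) := by
  unfold entropy
  by_cases hac : μ ≪ m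
  · have hiff := integrable_rnDeriv_mul_log_iff (μ := μ) (ν := m) hac
    by_cases hint : Integrable (llr μ m) μ
    · rw [if_pos ⟨hac, hiff.2 hint⟩]
      have h1 : klDiv μ m = ENNReal.ofReal (∫ x, llr μ m x ∂μ) := by
        rw [klDiv_of_ac_of_integrable hac hint]; simp
      have h2 := integral_llr_add_sub_measure_univ_nonneg hac hint
      simp only [probReal_univ, add_sub_cancel_right] at h2
      rw [h1, EReal.coe_ennreal_ofReal, max_eq_left h2, integral_rnDeriv_mul_log hac]
    · rw [if_neg (fun h => hint (hiff.1 h.2)), klDiv_of_not_integrable hint]; rfl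
  · rw [if_neg (fun h => hac h.1), klDiv_of_not_ac hac]; rfl

open InformationTheory in
lemma kl_var_of_le {M : Type*} [MeasurableSpace M] (m μ : Measure M)
    [IsProbabilityMeasure m] [IsProbabilityMeasure μ] (C : ℝ) (hC : 0 ≤ C)
    (h : klDiv μ m ≤ ENNReal.ofReal C) (g : M → ℝ) (hg : Measurable g) (k : ℝ)
    (hk : ∀ x, |g x| ≤ k) :
    ∫ x, g x ∂μ ≤ ∫ x, (Real.exp (g x) - 1) ∂m + C := by
  have hne : klDiv μ m ≠ ⊤ := ne_top_of_le_ne_top ENNReal.ofReal_ne_top h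
  obtain ⟨hac, hint⟩ := klDiv_ne_top_iff.1 hne
  have h1 : ∫ x, klFun (μ.rnDeriv m x).toReal ∂m ≤ C := by
    rw [← toReal_klDiv_eq_integral_klFun hac]
    exact ENNReal.toReal_le_of_le_ofReal hC h
  have hgi : Integrable g μ := Integrable.of_bound hg.aestronglyMeasurable k (ae_of_all _ hk)
  have hei : Integrable (fun x => Real.exp (g x) - 1) m := by
    refine Integrable.sub ?_ (integrable_const _)
    refine Integrable.of_bound (by fun_prop) (Real.exp k) (ae_of_all _ fun x => ?_)
    rw [Real.norm_eq_abs, Real.abs_exp]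
    exact Real.exp_le_exp.2 ((le_abs_self _).trans (hk x))
  have hki := (integrable_klFun_rnDeriv_iff hac).2 hint
  have h2 : ∫ x, (μ.rnDeriv m x).toReal • g x ∂m = ∫ x, g x ∂μ := integral_rnDeriv_smul hac
  rw [← h2]
  have h3 : Integrable (fun x => (μ.rnDeriv m x).toReal • g x) m :=
    (integrable_rnDeriv_smul_iff hac).2 hgi
  calc _ ≤ ∫ x, ((Real.exp (g x) - 1) + klFun (μ.rnDeriv m x).toReal) ∂m := by
        refine integral_mono h3 (hei.add hki) fun x => ?_
        simp only [smul_eq_mul, klFun_apply]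
        have hr : 0 ≤ (μ.rnDeriv m x).toReal := ENNReal.toReal_nonneg
        generalize (μ.rnDeriv m x).toReal = r at hr
        rcases hr.eq_or_lt with rfl | hr
        · simp; positivity
        · have := Real.add_one_le_exp (g x - Real.log r)
          rw [Real.exp_sub, Real.exp_log hr, le_div_iff₀ hr] at this
          nlinarith
    _ = ∫ x, (Real.exp (g x) - 1) ∂m + ∫ x, klFun (μ.rnDeriv m x).toReal ∂m :=
        integral_add hei hki
    _ ≤ _ := by linarith

lemma var_extend {M : Type*} [MetricSpace M] [CompactSpace M] [MeasurableSpace M] [BorelSpace M]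
    (m μ : Measure M) [IsProbabilityMeasure m] [IsProbabilityMeasure μ] (C : ℝ)
    (h : ∀ g : BoundedContinuousFunction M ℝ,
      ∫ x, g x ∂μ ≤ ∫ x, (Real.exp (g x) - 1) ∂m + C)
    (g : M → ℝ) (hg : Measurable g) (k : ℝ) (hk : ∀ x, |g x| ≤ k) :
    ∫ x, g x ∂μ ≤ ∫ x, (Real.exp (g x) - 1) ∂m + C := by
  have key : ∀ ε : ℝ, 0 < ε →
      ∫ x, g x ∂μ ≤ ∫ x, (Real.exp (g x) - 1) ∂m + C + (1 + Real.exp k) * ε := by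
    intro ε hε
    have hgi : ∀ ν : Measure M, IsFiniteMeasure ν → Integrable g ν := fun ν _ =>
      Integrable.of_bound hg.aestronglyMeasurable k (ae_of_all _ hk)
    obtain ⟨f, hf, hfi⟩ :=
      (hgi (μ + m) inferInstance).exists_boundedContinuous_integral_sub_le hε
    let H : C(M, ℝ) := ⟨fun x => max (-k) (min k (f x)), by fun_prop⟩
    let hh : BoundedContinuousFunction M ℝ := BoundedContinuousFunction.mkOfCompact H
    have hdef : ∀ x, hh x = max (-k) (min k (f x)) := fun x => rfl
    have hclose : ∀ x, |g x - hh x| ≤ |g x - f x| := by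
      intro x
      have := abs_le.1 (hk x)
      rw [hdef]
      rcases max_cases (-k) (min k (f x)) with h1 | h1 <;>
      rcases min_cases k (f x) with h2 | h2 <;>
      rcases abs_cases (g x - f x) with h3 | h3 <;> rw [abs_le] <;> constructor <;> linarith
    have hhk : ∀ x, hh x ≤ k := by
      intro x
      rw [hdef]
      exact max_le (by linarith [abs_nonneg (g x), hk x]) (min_le_left _ _)
    have hfμ : Integrable (fun x => f x) μ := f.integrable μ
    have hfm : Integrable (fun x => f x) m := f.integrable m
    have hhμ : Integrable (fun x => hh x) μ := hh.integrable μ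
    have dμ : Integrable (fun x => ‖g x - f x‖) μ := ((hgi μ inferInstance).sub hfμ).norm
    have dm : Integrable (fun x => ‖g x - f x‖) m := ((hgi m inferInstance).sub hfm).norm
    rw [integral_add_measure dμ dm] at hf
    have n1 : 0 ≤ ∫ x, ‖g x - f x‖ ∂μ := integral_nonneg fun x => norm_nonneg _
    have n2 : 0 ≤ ∫ x, ‖g x - f x‖ ∂m := integral_nonneg fun x => norm_nonneg _
    have s1 : ∫ x, g x ∂μ ≤ ∫ x, hh x ∂μ + ∫ x, ‖g x - f x‖ ∂μ := by
      rw [← integral_add hhμ dμ]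
      refine integral_mono (hgi μ inferInstance) (hhμ.add dμ) fun x => ?_
      have := (le_abs_self _).trans (hclose x)
      simp only [Real.norm_eq_abs]
      linarith
    have hei : ∀ u : M → ℝ, Measurable u → (∀ x, u x ≤ k) →
        Integrable (fun x => Real.exp (u x) - 1) m := by
      intro u hu huk
      refine Integrable.sub ?_ (integrable_const _)
      refine Integrable.of_bound (by fun_prop) (Real.exp k) (ae_of_all _ fun x => ?_)
      rw [Real.norm_eq_abs, Real.abs_exp]
      exact Real.exp_le_exp.2 (huk x)
    have eg := hei g hg fun x => (le_abs_self _).trans (hk x)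
    have s2 : ∫ x, (Real.exp (hh x) - 1) ∂m ≤
        ∫ x, (Real.exp (g x) - 1) ∂m + Real.exp k * ∫ x, ‖g x - f x‖ ∂m := by
      rw [← integral_const_mul, ← integral_add eg (dm.const_mul _)]
      refine integral_mono (hei hh hh.continuous.measurable hhk) (eg.add (dm.const_mul _))
        fun x => ?_
      simp only [Real.norm_eq_abs]
      have a1 := Real.add_one_le_exp (g x - hh x)
      rw [Real.exp_sub, le_div_iff₀ (Real.exp_pos _)] at a1
      have a2 := neg_abs_le (g x - hh x)
      have a3 := hclose x
      have a4 : Real.exp (hh x) * |g x - hh x| ≤ Real.exp k * |g x - f x| :=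
        mul_le_mul (Real.exp_le_exp.2 (hhk x)) a3 (abs_nonneg _) (Real.exp_pos _).le
      have a5 := Real.exp_pos (hh x)
      nlinarith
    have s3 := h hh
    have := Real.exp_pos k
    nlinarith
  refine le_of_forall_pos_le_add fun δ hδ => ?_
  have hp : 0 < 1 + Real.exp k := by positivity
  have := key (δ / (1 + Real.exp k)) (by positivity)
  rwa [mul_div_cancel₀ _ hp.ne'] at this

open InformationTheory Filter Topology in
lemma kl_le_of_var {M : Type*} [MeasurableSpace M] (m μ : Measure M)
    [IsProbabilityMeasure m] [IsProbabilityMeasure μ] (C : ℝ)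
    (h : ∀ (g : M → ℝ) (k : ℝ), Measurable g → (∀ x, |g x| ≤ k) →
      ∫ x, g x ∂μ ≤ ∫ x, (Real.exp (g x) - 1) ∂m + C) :
    klDiv μ m ≤ ENNReal.ofReal C := by
  have hac : μ ≪ m := by
    refine Measure.AbsolutelyContinuous.mk fun A hA hmA => ?_
    by_contra hne
    have hpos : 0 < μ.real A := by
      rw [measureReal_def]
      exact ENNReal.toReal_pos hne (measure_ne_top _ _)
    have hb : ∀ n : ℕ, n * μ.real A ≤ C := by
      intro n
      have := h (A.indicator fun _ => (n : ℝ)) n (measurable_const.indicator hA) (by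
        intro x
        by_cases hx : x ∈ A <;> simp [hx])
      rw [integral_indicator_const _ hA] at this
      have h0 : ∫ x, (Real.exp (A.indicator (fun _ => (n : ℝ)) x) - 1) ∂m = 0 := by
        refine integral_eq_zero_of_ae ?_
        have : ∀ᵐ x ∂m, x ∉ A := measure_eq_zero_iff_ae_notMem.1 hmA
        filter_upwards [this] with x hx
        simp [hx]
      rw [h0, smul_eq_mul] at this
      linarith
    obtain ⟨n, hn⟩ := exists_nat_gt (C / μ.real A)
    rw [div_lt_iff₀ hpos] at hn
    linarith [hb n]
  rw [klDiv_eq_lintegral_klFun_of_ac hac]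
  set r : M → ℝ := fun x => (μ.rnDeriv m x).toReal with hr
  have hrm : Measurable r := (Measure.measurable_rnDeriv μ m).ennreal_toReal
  have hr0 : ∀ x, 0 ≤ r x := fun x => ENNReal.toReal_nonneg
  let t : ℕ → M → ℝ := fun n x => max ((n + 1 : ℝ)⁻¹) (min (n + 1 : ℝ) (r x))
  have htm : ∀ n, Measurable (t n) := fun n => by fun_prop
  have hn1 : ∀ n : ℕ, (1 : ℝ) ≤ n + 1 := fun n => by linarith [Nat.cast_nonneg (α := ℝ) n]
  have hninv : ∀ n : ℕ, (n + 1 : ℝ)⁻¹ ≤ 1 := fun n => inv_le_one_of_one_le₀ (hn1 n)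
  have htlo : ∀ (n : ℕ) (x : M), (n + 1 : ℝ)⁻¹ ≤ t n x := fun n x => le_max_left _ _
  have hthi : ∀ (n : ℕ) (x : M), t n x ≤ n + 1 := fun n x =>
    max_le ((hninv n).trans (hn1 n)) (min_le_left _ _)
  have htpos : ∀ n x, 0 < t n x := fun n x =>
    lt_of_lt_of_le (by positivity) (htlo n x)
  let φ : ℕ → M → ℝ := fun n x => r x * Real.log (t n x) - (t n x - 1)
  have hφ0 : ∀ n x, 0 ≤ φ n x := by
    intro n x
    have h1 : t n x - 1 ≤ t n x * Real.log (t n x) := by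
      have := Real.one_sub_inv_le_log_of_pos (htpos n x)
      have h2 := mul_le_mul_of_nonneg_left this (htpos n x).le
      rw [mul_sub, mul_inv_cancel₀ (htpos n x).ne'] at h2
      linarith
    have h2 : 0 ≤ (r x - t n x) * Real.log (t n x) := by
      rcases le_or_gt (t n x) 1 with ht | ht
      · have : r x ≤ t n x ∨ r x = t n x ∨ t n x = n + 1 := by
          simp only [t]
          rcases max_cases ((n + 1 : ℝ)⁻¹) (min (n + 1 : ℝ) (r x)) with h1 | h1 <;>
          rcases min_cases (n + 1 : ℝ) (r x) with h2 | h2 <;> grind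
        rcases this with h | h | h
        · exact mul_nonneg_of_nonpos_of_nonpos (by linarith)
            (Real.log_nonpos (htpos n x).le ht)
        · simp [h]
        · have : t n x = 1 := le_antisymm ht (h ▸ hn1 n)
          simp [this]
      · have : t n x ≤ r x := by
          have := hninv n
          simp only [t] at ht ⊢
          rcases max_cases ((n + 1 : ℝ)⁻¹) (min (n + 1 : ℝ) (r x)) with h1 | h1 <;>
          rcases min_cases (n + 1 : ℝ) (r x) with h2 | h2 <;> grind
        exact mul_nonneg (by linarith) (Real.log_nonneg ht.le)
    simp only [φ]; nlinarith
  have hlim : ∀ x, Tendsto (fun n => φ n x) atTop (𝓝 (klFun (r x))) := by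
    intro x
    rcases (hr0 x).eq_or_lt with hx | hx
    · have : ∀ n : ℕ, φ n x = 1 - 1 / ((n : ℝ) + 1) := by
        intro n
        have e : t n x = (n + 1 : ℝ)⁻¹ := by
          simp only [t, ← hx]
          rw [min_eq_right (by linarith [hn1 n]), max_eq_left (by positivity)]
        simp only [φ, e, ← hx]; ring
      simp only [this, ← hx, klFun_zero]
      simpa using tendsto_one_div_add_atTop_nhds_zero_nat (𝕜 := ℝ) |>.const_sub 1
    · obtain ⟨N, hN⟩ := exists_nat_gt (max (r x) (r x)⁻¹)
      refine tendsto_const_nhds.congr' ?_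
      filter_upwards [eventually_ge_atTop N] with n hn
      have hn' : (N : ℝ) ≤ n := by exact_mod_cast hn
      have e1 : r x ≤ n + 1 := by linarith [le_max_left (r x) (r x)⁻¹]
      have e2 : (n + 1 : ℝ)⁻¹ ≤ r x :=
        inv_le_of_inv_le₀ hx (by linarith [le_max_right (r x) (r x)⁻¹])
      have e : t n x = r x := by
        simp only [t]; rw [min_eq_right e1, max_eq_right e2]
      simp only [φ, e, klFun_apply]; ring
  have hbound : ∀ n, ∫⁻ x, ENNReal.ofReal (φ n x) ∂m ≤ ENNReal.ofReal C := by
    intro n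
    have hlb : ∀ x, |Real.log (t n x)| ≤ Real.log (n + 1) := by
      intro x
      rw [abs_le]
      constructor
      · rw [← Real.log_inv]
        exact Real.log_le_log (by positivity) (htlo n x)
      · exact Real.log_le_log (htpos n x) (hthi n x)
    have hlm : Measurable fun x => Real.log (t n x) := (htm n).log
    have hli : Integrable (fun x => Real.log (t n x)) μ :=
      Integrable.of_bound hlm.aestronglyMeasurable _ (ae_of_all _ hlb)
    have h3 : Integrable (fun x => r x * Real.log (t n x)) m :=
      (integrable_rnDeriv_smul_iff hac).2 hli
    have h4 : ∫ x, r x * Real.log (t n x) ∂m = ∫ x, Real.log (t n x) ∂μ :=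
      integral_rnDeriv_smul hac
    have h5 : Integrable (fun x => t n x - 1) m := by
      refine Integrable.sub ?_ (integrable_const _)
      refine Integrable.of_bound (htm n).aestronglyMeasurable (n + 1) (ae_of_all _ fun x => ?_)
      rw [Real.norm_eq_abs, abs_of_pos (htpos n x)]
      exact hthi n x
    have h6 := h _ _ hlm hlb
    simp only [Real.exp_log (htpos n _)] at h6
    have h7 : Integrable (φ n) m := h3.sub h5
    rw [← ofReal_integral_eq_lintegral_ofReal h7 (ae_of_all _ (hφ0 n))]
    refine ENNReal.ofReal_le_ofReal ?_
    have : ∫ x, φ n x ∂m = _ := integral_sub h3 h5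
    change ∫ x, φ n x ∂m ≤ C
    rw [this, h4]
    linarith
  calc ∫⁻ x, ENNReal.ofReal (klFun (r x)) ∂m
      = ∫⁻ x, liminf (fun n => ENNReal.ofReal (φ n x)) atTop ∂m := by
        congr 1; ext x
        exact ((ENNReal.continuous_ofReal.tendsto _).comp (hlim x)).liminf_eq.symm
    _ ≤ liminf (fun n => ∫⁻ x, ENNReal.ofReal (φ n x) ∂m) atTop := by
        refine lintegral_liminf_le fun n => ?_
        have := htm n
        exact ((hrm.mul (htm n).log).sub ((htm n).sub_const 1)).ennreal_ofReal
    _ ≤ ENNReal.ofReal C := by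
        refine liminf_le_of_le (by isBoundedDefault) fun b hb => ?_
        obtain ⟨n, hn⟩ := hb.exists
        exact hn.trans (hbound n)

open InformationTheory in
lemma lsc_klDiv {M : Type*} [MetricSpace M] [CompactSpace M] [MeasurableSpace M] [BorelSpace M]
    (m : Measure M) [IsProbabilityMeasure m] :
    LowerSemicontinuous fun μ : ProbabilityMeasure M => klDiv (μ : Measure M) m := by
  rw [lowerSemicontinuous_iff_isClosed_preimage]
  intro c
  by_cases hc : c = ⊤
  · simp [hc]
  have hcr : c = ENNReal.ofReal c.toReal := (ENNReal.ofReal_toReal hc).symm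
  have : (fun μ : ProbabilityMeasure M => klDiv (μ : Measure M) m) ⁻¹' Set.Iic c =
      ⋂ g : BoundedContinuousFunction M ℝ, {μ : ProbabilityMeasure M |
        ∫ x, g x ∂(μ : Measure M) ≤ ∫ x, (Real.exp (g x) - 1) ∂m + c.toReal} := by
    ext μ
    simp only [Set.mem_preimage, Set.mem_Iic, Set.mem_iInter, Set.mem_ofPred_eq]
    constructor
    · intro h g
      rw [hcr] at h
      exact kl_var_of_le m μ _ ENNReal.toReal_nonneg h g g.continuous.measurable ‖g‖
        g.norm_coe_le_norm
    · intro h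
      rw [hcr]
      exact kl_le_of_var m μ _ fun g k hg hk => var_extend m μ _ h g hg k hk
  rw [this]
  refine isClosed_iInter fun g => ?_
  refine isClosed_le ?_ continuous_const
  exact ProbabilityMeasure.continuous_integral_boundedContinuousFunction g

lemma cont_interaction {M : Type*} [MetricSpace M] [CompactSpace M] [MeasurableSpace M]
    [BorelSpace M] (W : M → M → ℝ) (hW : Continuous fun p : M × M => W p.1 p.2) :
    Continuous fun μ : ProbabilityMeasure M => interactionEnergy W (μ : Measure M) := by
  let G : BoundedContinuousFunction (M × M) ℝ := BoundedContinuousFunction.mkOfCompact ⟨_, hW⟩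
  have h1 : Continuous fun μ : ProbabilityMeasure M =>
      ∫ p, G p ∂((μ.prod μ : ProbabilityMeasure (M × M)) : Measure (M × M)) :=
    (ProbabilityMeasure.continuous_integral_boundedContinuousFunction G).comp
      (ProbabilityMeasure.continuous_prod.comp (continuous_id.prodMk continuous_id))
  unfold interactionEnergy
  refine continuous_const.mul (h1.congr fun μ => ?_)
  rw [ProbabilityMeasure.toMeasure_prod, integral_prod _ (G.integrable _)]
  rfl

open InformationTheory in
lemma lsc_freeEnergy {M : Type*} [MetricSpace M] [CompactSpace M] [MeasurableSpace M]
    [BorelSpace M] (m : Measure M) [IsProbabilityMeasure m]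
    (W : M → M → ℝ) (hW : Continuous fun p : M × M => W p.1 p.2) (γ : ℝ) (hγ : 0 < γ) :
    LowerSemicontinuous fun μ : ProbabilityMeasure M => freeEnergy m W γ (μ : Measure M) := by
  unfold freeEnergy
  simp only [entropy_eq_klDiv]
  refine LowerSemicontinuous.add' ?_ ?_ ?_
  · have h1 : LowerSemicontinuous fun μ : ProbabilityMeasure M =>
        ((klDiv (μ : Measure M) m : ENNReal) : EReal) :=
      continuous_coe_ennreal_ereal.comp_lowerSemicontinuous (lsc_klDiv m)
        EReal.coe_ennreal_strictMono.monotone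
    have hp : ((γ⁻¹ : ℝ) : EReal) ≠ 0 := by exact_mod_cast (inv_pos.2 hγ).ne'
    have hmulc : Continuous fun x : EReal => ((γ⁻¹ : ℝ) : EReal) * x := by
      refine continuous_iff_continuousAt.2 fun x => ?_
      exact (EReal.continuousAt_mul (p := (((γ⁻¹ : ℝ) : EReal), x)) (Or.inl hp) (Or.inl hp)
        (Or.inl (EReal.coe_ne_bot _)) (Or.inl (EReal.coe_ne_top _))).comp
        (f := fun x : EReal => (((γ⁻¹ : ℝ) : EReal), x)) (by fun_prop)
    refine Continuous.comp_lowerSemicontinuous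
      (g := fun x : EReal => ((γ⁻¹ : ℝ) : EReal) * x) hmulc h1 ?_
    intro a b hab
    exact mul_le_mul_of_nonneg_left hab (by exact_mod_cast (inv_pos.2 hγ).le)
  · exact (continuous_coe_real_ereal.comp (cont_interaction W hW)).lowerSemicontinuous
  · intro μ
    exact EReal.continuousAt_add (Or.inr (EReal.coe_ne_bot _)) (Or.inr (EReal.coe_ne_top _))

lemma exists_min {M : Type*} [MetricSpace M] [CompactSpace M] [MeasurableSpace M]
    [BorelSpace M] (m : Measure M) [IsProbabilityMeasure m]
    (W : M → M → ℝ) (hW : Continuous fun p : M × M => W p.1 p.2) (γ : ℝ) (hγ : 0 < γ) :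
    ∃ μ : Measure M, IsProbabilityMeasure μ ∧
      ∀ ν : Measure M, IsProbabilityMeasure ν → freeEnergy m W γ μ ≤ freeEnergy m W γ ν := by
  obtain ⟨μ, -, hμ⟩ := LowerSemicontinuousOn.exists_isMinOn (α := ProbabilityMeasure M) (s := Set.univ)
    ⟨(⟨m, inferInstance⟩ : ProbabilityMeasure M), Set.mem_univ _⟩ isCompact_univ
    ((lsc_freeEnergy m W hW γ hγ).lowerSemicontinuousOn _)
  exact ⟨μ, inferInstance, fun ν hν => hμ (Set.mem_univ (⟨ν, hν⟩ : ProbabilityMeasure M))⟩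

open InformationTheory in
lemma freeEnergy_self {M : Type*} [MeasurableSpace M] (m : Measure M) [IsProbabilityMeasure m]
    (W : M → M → ℝ) (γ : ℝ) :
    freeEnergy m W γ m = ((interactionEnergy W m : ℝ) : EReal) := by
  unfold freeEnergy
  rw [entropy_eq_klDiv, klDiv_self]
  simp

open InformationTheory in
lemma freeEnergy_cases {M : Type*} [MeasurableSpace M] (m μ : Measure M) [IsProbabilityMeasure m]
    [IsProbabilityMeasure μ] (W : M → M → ℝ) :
    (∀ γ : ℝ, 0 < γ → freeEnergy m W γ μ = ⊤) ∨
    ∃ e : ℝ, 0 ≤ e ∧ (μ ≠ m → 0 < e) ∧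
      ∀ γ : ℝ, freeEnergy m W γ μ = ((γ⁻¹ * e + interactionEnergy W μ : ℝ) : EReal) := by
  by_cases h : klDiv μ m = ⊤
  · left
    intro γ hγ
    unfold freeEnergy
    rw [entropy_eq_klDiv, h, EReal.coe_ennreal_top,
      EReal.coe_mul_top_of_pos (inv_pos.2 hγ), EReal.top_add_coe]
  · right
    refine ⟨(klDiv μ m).toReal, ENNReal.toReal_nonneg, fun hne => ?_, fun γ => ?_⟩
    · exact ENNReal.toReal_pos (fun h0 => hne (klDiv_eq_zero_iff.1 h0)) h
    · unfold freeEnergy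
      rw [entropy_eq_klDiv, EReal.coe_add, EReal.coe_mul, EReal.coe_ennreal_toReal h]

/-- Under (i) uniqueness of the minimizer `m` for small `γ` and (ii) existence of a competitor
at some `γ̃`, the value `γ_c = sup{γ > 0 : m minimizes F_γ}` is a transition point. -/
theorem stmt13 {M : Type*} [MetricSpace M] [CompactSpace M] [MeasurableSpace M] [BorelSpace M]
    (m : Measure M) [IsProbabilityMeasure m]
    (W : M → M → ℝ) (hWcont : Continuous fun p : M × M => W p.1 p.2)
    (hWsymm : ∀ x y, W x y = W y x)
    (γ₀ : ℝ) (hγ₀ : 0 < γ₀)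
    (hsmall : ∀ γ : ℝ, 0 < γ → γ ≤ γ₀ →
      (∀ ν : Measure M, IsProbabilityMeasure ν → freeEnergy m W γ m ≤ freeEnergy m W γ ν) ∧
      (∀ μ : Measure M, IsProbabilityMeasure μ →
        (∀ ν : Measure M, IsProbabilityMeasure ν → freeEnergy m W γ μ ≤ freeEnergy m W γ ν) →
        μ = m))
    (γt : ℝ) (hγt : 0 < γt) (μt : Measure M) (hμt : IsProbabilityMeasure μt) (hμtne : μt ≠ m)
    (hμtle : freeEnergy m W γt μt ≤ freeEnergy m W γt m)
    (γc : ℝ)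
    (hγc : γc = sSup {γ : ℝ | 0 < γ ∧
      ∀ ν : Measure M, IsProbabilityMeasure ν → freeEnergy m W γ m ≤ freeEnergy m W γ ν}) :
    γ₀ ≤ γc ∧ γc ≤ γt ∧
    (∀ γ : ℝ, 0 < γ → γ < γc →
      (∀ ν : Measure M, IsProbabilityMeasure ν → freeEnergy m W γ m ≤ freeEnergy m W γ ν) ∧
      (∀ μ : Measure M, IsProbabilityMeasure μ →
        (∀ ν : Measure M, IsProbabilityMeasure ν → freeEnergy m W γ μ ≤ freeEnergy m W γ ν) →
        μ = m)) ∧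
    (∀ ν : Measure M, IsProbabilityMeasure ν → freeEnergy m W γc m ≤ freeEnergy m W γc ν) ∧
    (∀ γ : ℝ, γc < γ → ∃ μ : Measure M, IsProbabilityMeasure μ ∧ μ ≠ m ∧
      ∀ ν : Measure M, IsProbabilityMeasure ν → freeEnergy m W γ μ ≤ freeEnergy m W γ ν) := by
  set S : Set ℝ := {γ : ℝ | 0 < γ ∧
      ∀ ν : Measure M, IsProbabilityMeasure ν → freeEnergy m W γ m ≤ freeEnergy m W γ ν} with hS
  have hub : ∀ γ ∈ S, γ ≤ γt := by
    rintro γ ⟨hγ, hmin⟩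
    by_contra hlt
    push Not at hlt
    have h1 := hmin μt hμt
    rw [freeEnergy_self] at h1 hμtle
    rcases freeEnergy_cases m μt W with ht | ⟨e, -, he, hF⟩
    · rw [ht γt hγt] at hμtle
      exact absurd hμtle (not_le.2 (EReal.coe_lt_top _))
    · rw [hF, EReal.coe_le_coe_iff] at h1 hμtle
      have h2 : γ⁻¹ < γt⁻¹ := inv_strictAnti₀ hγt hlt
      nlinarith [he hμtne]
  have hbdd : BddAbove S := ⟨γt, hub⟩
  have h0S : γ₀ ∈ S := ⟨hγ₀, (hsmall γ₀ hγ₀ le_rfl).1⟩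
  have h0c : γ₀ ≤ γc := hγc ▸ le_csSup hbdd h0S
  have hstrict : ∀ γ : ℝ, 0 < γ → γ < γc → ∀ ν : Measure M, IsProbabilityMeasure ν → ν ≠ m →
      freeEnergy m W γ m < freeEnergy m W γ ν := by
    intro γ hγ hlt ν hν hne
    rw [hγc] at hlt
    obtain ⟨γ', ⟨hγ', hmin⟩, hlt'⟩ := exists_lt_of_lt_csSup ⟨γ₀, h0S⟩ hlt
    have h1 := hmin ν hν
    rw [freeEnergy_self] at h1 ⊢
    rcases freeEnergy_cases m ν W with ht | ⟨e, -, he, hF⟩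
    · rw [ht γ hγ]; exact EReal.coe_lt_top _
    · rw [hF, EReal.coe_le_coe_iff] at h1
      rw [hF, EReal.coe_lt_coe_iff]
      have h2 : γ'⁻¹ < γ⁻¹ := inv_strictAnti₀ hγ hlt'
      nlinarith [he hne]
  have hcpos : 0 < γc := lt_of_lt_of_le hγ₀ h0c
  refine ⟨h0c, ?_, ?_, ?_, ?_⟩
  · rw [hγc]; exact csSup_le ⟨γ₀, h0S⟩ hub
  · intro γ hγ hlt
    refine ⟨fun ν hν => ?_, fun μ hμ hmin => ?_⟩
    · by_cases hne : ν = m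
      · rw [hne]
      · exact (hstrict γ hγ hlt ν hν hne).le
    · by_contra hne
      exact absurd (hmin m inferInstance) (not_le.2 (hstrict γ hγ hlt μ hμ hne))
  · intro ν hν
    by_cases hne : ν = m
    · rw [hne]
    rcases freeEnergy_cases m ν W with ht | ⟨e, -, he, hF⟩
    · rw [ht γc hcpos]; exact le_top
    · rw [freeEnergy_self, hF, EReal.coe_le_coe_iff]
      have hcont : Filter.Tendsto (fun γ : ℝ => γ⁻¹ * e + interactionEnergy W ν)
          (nhdsWithin γc (Set.Iio γc)) (nhds (γc⁻¹ * e + interactionEnergy W ν)) :=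
        (((continuousAt_inv₀ hcpos.ne').mul continuousAt_const).add
          continuousAt_const).tendsto.mono_left nhdsWithin_le_nhds
      refine ge_of_tendsto hcont ?_
      filter_upwards [Ioo_mem_nhdsLT hcpos] with γ hγ
      have := hstrict γ hγ.1 hγ.2 ν hν hne
      rw [freeEnergy_self, hF, EReal.coe_lt_coe_iff] at this
      exact this.le
  · intro γ hlt
    have hγ : 0 < γ := hcpos.trans hlt
    obtain ⟨μ, hμ, hmin⟩ := exists_min m W hWcont γ hγ
    refine ⟨μ, hμ, ?_, hmin⟩
    rintro rfl
    have : γ ≤ γc := by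
      rw [hγc]; exact le_csSup hbdd ⟨hγ, hmin⟩
    linarith
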